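/- arXiv:1604.06665 — 7 statements merged into one kernel-verified Lean document; each statement's English description precedes it below -/
import Mathlib

section
/- Let (Ω, μ) be a measure space with μ(Ω) < ∞, let f : Ω → ℝ be measurable and essentially bounded, and let c₁, c₂ ∈ ℝ. Define r : Ω → ℝ by r(x) = (f(x) − c₂)² − (f(x) − c₁)² + 1/2. Then for every measurable u : Ω → {0,1} one has (1/2)∫_Ω (u − r)² dμ = ∫_Ω u·((f − c₁)² − (f − c₂)²) dμ + (1/2)∫_Ω r² dμ. In particular, the Chan–Vese data energy u ↦ ∫_Ω u·((f − c₁)² − (f − c₂)²) dμ and the ROF-type energy u ↦ (1/2)∫_Ω (u − r)² dμ differ by a constant independent of u, and hence have the same minimizers over any family of {0,1}-valued measurable functions. -/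
open MeasureTheory

/-- On a finite measure space, for essentially bounded measurable `f` and
binary (`{0,1}`-valued) measurable `u`, the Chan–Vese data energy and the ROF-type energy
`(1/2)∫ (u - r)²` with `r = (f - c₂)² - (f - c₁)² + 1/2` differ by a constant independent
of `u`, hence they have the same minimizers over any family of binary measurable functions. -/
theorem stmt0 {Ω : Type*} [MeasurableSpace Ω] (μ : Measure Ω) [IsFiniteMeasure μ]
    (f : Ω → ℝ) (hf : Measurable f) (hfb : ∃ C : ℝ, ∀ᵐ x ∂μ, |f x| ≤ C)
    (c₁ c₂ : ℝ) (r : Ω → ℝ)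
    (hr : ∀ x, r x = (f x - c₂)^2 - (f x - c₁)^2 + 1/2) :
    (∀ u : Ω → ℝ, Measurable u → (∀ x, u x = 0 ∨ u x = 1) →
      (1/2) * ∫ x, (u x - r x)^2 ∂μ
        = (∫ x, u x * ((f x - c₁)^2 - (f x - c₂)^2) ∂μ) + (1/2) * ∫ x, (r x)^2 ∂μ) ∧
    (∀ U : Set (Ω → ℝ),
      (∀ u ∈ U, Measurable u ∧ ∀ x, u x = 0 ∨ u x = 1) →
      ∀ ustar ∈ U,
        ((∀ v ∈ U, (∫ x, ustar x * ((f x - c₁)^2 - (f x - c₂)^2) ∂μ)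
            ≤ ∫ x, v x * ((f x - c₁)^2 - (f x - c₂)^2) ∂μ) ↔
         (∀ v ∈ U, (1/2) * (∫ x, (ustar x - r x)^2 ∂μ)
            ≤ (1/2) * ∫ x, (v x - r x)^2 ∂μ))) := by
  obtain ⟨C, hC⟩ := hfb
  have hr' : ∀ x, r x = 2 * (c₁ - c₂) * f x + (c₂^2 - c₁^2 + 1/2) := fun x => by
    rw [hr x]; ring
  have hrm : Measurable r := by
    have : r = fun x => 2 * (c₁ - c₂) * f x + (c₂^2 - c₁^2 + 1/2) := funext hr'
    rw [this]; fun_prop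
  have hrb : ∀ᵐ x ∂μ, |r x| ≤ |2 * (c₁ - c₂)| * C + |c₂^2 - c₁^2 + 1/2| := by
    filter_upwards [hC] with x hx
    rw [hr' x]
    refine (abs_add_le _ _).trans ?_
    rw [abs_mul]
    gcongr
  generalize |2 * (c₁ - c₂)| * C + |c₂^2 - c₁^2 + 1/2| = D at hrb
  have key : ∀ u : Ω → ℝ, Measurable u → (∀ x, u x = 0 ∨ u x = 1) →
      (1/2) * ∫ x, (u x - r x)^2 ∂μ
        = (∫ x, u x * ((f x - c₁)^2 - (f x - c₂)^2) ∂μ) + (1/2) * ∫ x, (r x)^2 ∂μ := by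
    intro u hu h01
    have i1 : Integrable (fun x => u x * ((f x - c₁)^2 - (f x - c₂)^2)) μ := by
      refine Integrable.of_bound (C := D + 1/2) (by fun_prop) ?_
      filter_upwards [hrb] with x hx
      have e : (f x - c₁)^2 - (f x - c₂)^2 = 1/2 - r x := by rw [hr x]; ring
      rw [e, Real.norm_eq_abs]
      have := abs_le.1 hx
      have h0 := (abs_nonneg _).trans hx
      rcases h01 x with h | h <;> rw [h, abs_le] <;> constructor <;> linarith
    have i2 : Integrable (fun x => (1/2) * (r x)^2) μ := by
      refine Integrable.const_mul ?_ _
      refine Integrable.of_bound (C := D^2) (by fun_prop) ?_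
      filter_upwards [hrb] with x hx
      rw [norm_pow, Real.norm_eq_abs]
      gcongr
    rw [← integral_const_mul, ← integral_const_mul, ← integral_add i1 i2]
    refine integral_congr_ae (Filter.Eventually.of_forall fun x => ?_)
    have e : (f x - c₁)^2 - (f x - c₂)^2 = 1/2 - r x := by rw [hr x]; ring
    simp only [e]
    rcases h01 x with h | h <;> rw [h] <;> ring
  refine ⟨key, fun U hU us hus => forall₂_congr fun v hv => ?_⟩
  rw [key us (hU us hus).1 (hU us hus).2, key v (hU v hv).1 (hU v hv).2]
  exact (add_le_add_iff_right _).symm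
end

section
/- For u : ℝ^d → ℝ locally integrable, define the (isotropic) total variation TV(u) = sup{ −∫ u(x) (div φ)(x) dx : φ ∈ C_c¹(ℝ^d, ℝ^d), |φ(x)| ≤ 1 for all x } ∈ [0, ∞], where |·| is the Euclidean norm. Let s : ℝ^d → ℝ be bounded, measurable and integrable, let α > 0, and consider the convex energy E(v) = ∫ v·s dx + α·TV(v) over the admissible set K = { v ∈ L¹(ℝ^d) : 0 ≤ v ≤ 1 a.e., TV(v) < ∞ }. If v* ∈ K minimizes E over K, then for almost every threshold t ∈ (0,1), the indicator function of the super-level set {x : v*(x) > t} belongs to K and is also a minimizer of E over K; in particular it minimizes E among all {0,1}-valued functions in K. -/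
open MeasureTheory
open scoped ENNReal

/-- The divergence of a vector field `φ : ℝ^d → ℝ^d`. -/
noncomputable def divg {d : ℕ}
    (φ : EuclideanSpace ℝ (Fin d) → EuclideanSpace ℝ (Fin d))
    (x : EuclideanSpace ℝ (Fin d)) : ℝ :=
  ∑ i, fderiv ℝ φ x (EuclideanSpace.single i (1:ℝ)) i

/-- The (isotropic) total variation:
`TV u = sup { −∫ u div φ : φ ∈ C_c¹, |φ x| ≤ 1 ∀x } ∈ [0, ∞]`. -/
noncomputable def TV {d : ℕ} (u : EuclideanSpace ℝ (Fin d) → ℝ) : ℝ≥0∞ :=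
  ⨆ φ : {φ : EuclideanSpace ℝ (Fin d) → EuclideanSpace ℝ (Fin d) //
      ContDiff ℝ 1 φ ∧ HasCompactSupport φ ∧ ∀ x, ‖φ x‖ ≤ 1},
    ENNReal.ofReal (-∫ x, u x * divg φ.1 x)

/-- The convex relaxed Chan–Vese energy `E(v) = ∫ v·s + α·TV(v)`. -/
noncomputable def Erelax {d : ℕ} (s : EuclideanSpace ℝ (Fin d) → ℝ) (α : ℝ)
    (v : EuclideanSpace ℝ (Fin d) → ℝ) : ℝ :=
  (∫ x, v x * s x) + α * (TV v).toReal

/-- The admissible set `K = { v ∈ L¹ : 0 ≤ v ≤ 1 a.e., TV v < ∞ }`. -/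
def Kadm {d : ℕ} : Set (EuclideanSpace ℝ (Fin d) → ℝ) :=
  {v | Integrable v ∧ (∀ᵐ x, v x ∈ Set.Icc (0:ℝ) 1) ∧ TV v < ⊤}

open Filter Topology

section TVproof

variable {d : ℕ}

local notation "𝔼" => EuclideanSpace ℝ (Fin d)

def Adm (φ : 𝔼 → 𝔼) : Prop := ContDiff ℝ 1 φ ∧ HasCompactSupport φ ∧ ∀ x, ‖φ x‖ ≤ 1

lemma divg_continuous {φ : 𝔼 → 𝔼} (h : ContDiff ℝ 1 φ) : Continuous (divg φ) := by
  unfold divg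
  have := h.continuous_fderiv (by norm_num)
  fun_prop

lemma divg_hasCompactSupport {φ : 𝔼 → 𝔼} (h : HasCompactSupport φ) :
    HasCompactSupport (divg φ) := by
  refine (h.fderiv (𝕜 := ℝ)).mono' ?_
  intro x hx
  apply subset_tsupport
  intro h0
  apply hx
  simp [divg, h0]

lemma divg_integrable {φ : 𝔼 → 𝔼} (h : ContDiff ℝ 1 φ) (hc : HasCompactSupport φ) :
    Integrable (divg φ) :=
  (divg_continuous h).integrable_of_hasCompactSupport (divg_hasCompactSupport hc)

lemma le_TV {u : 𝔼 → ℝ} {φ : 𝔼 → 𝔼} (h : Adm φ) (hu : TV u < ⊤) :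
    -∫ x, u x * divg φ x ≤ (TV u).toReal := by
  have h1 : ENNReal.ofReal (-∫ x, u x * divg φ x) ≤ TV u :=
    le_iSup (fun φ : {φ : 𝔼 → 𝔼 //
      ContDiff ℝ 1 φ ∧ HasCompactSupport φ ∧ ∀ x, ‖φ x‖ ≤ 1} =>
      ENNReal.ofReal (-∫ x, u x * divg φ.1 x)) ⟨φ, h⟩
  exact (ENNReal.ofReal_le_iff_le_toReal hu.ne).1 h1

lemma TV_le {u : 𝔼 → ℝ} {C : ℝ} (h : ∀ φ : 𝔼 → 𝔼, Adm φ → -∫ x, u x * divg φ x ≤ C) :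
    TV u ≤ ENNReal.ofReal C :=
  iSup_le fun φ => ENNReal.ofReal_le_ofReal (h φ.1 φ.2)

lemma adm_zero : Adm (fun _ : 𝔼 => (0 : 𝔼)) :=
  ⟨contDiff_const, HasCompactSupport.zero, by simp⟩

lemma divg_zero (x : 𝔼) : divg (fun _ : 𝔼 => (0 : 𝔼)) x = 0 := by
  simp [divg]

lemma ibp {w : 𝔼 → ℝ} {φ : 𝔼 → 𝔼} (hw : ContDiff ℝ 1 w) (h : ContDiff ℝ 1 φ)
    (hc : HasCompactSupport φ) :
    -∫ x, w x * divg φ x = ∫ x, fderiv ℝ w x (φ x) := by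
  have hi : ∀ i, ContDiff ℝ 1 (fun x => φ x i) := fun i => by fun_prop
  have hci : ∀ i, HasCompactSupport (fun x => φ x i) := fun i => by
    refine hc.mono ?_
    intro x hx h0
    apply hx
    simp [h0]
  have hd : ∀ x i, fderiv ℝ φ x (EuclideanSpace.single i (1:ℝ)) i
      = fderiv ℝ (fun x => φ x i) x (EuclideanSpace.single i (1:ℝ)) := by
    intro x i
    have h1 : HasFDerivAt φ (fderiv ℝ φ x) x :=
      (h.differentiable (by norm_num) x).hasFDerivAt
    let P : 𝔼 →L[ℝ] ℝ := EuclideanSpace.proj i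
    have h3 : HasFDerivAt (fun x => φ x i) (P.comp (fderiv ℝ φ x)) x :=
      P.hasFDerivAt.comp x h1
    rw [h3.fderiv]
    rfl
  have hwc := hw.continuous
  have hwd := hw.continuous_fderiv (by norm_num)
  have I1 : ∀ i, Integrable (fun x => w x * fderiv ℝ (fun x => φ x i) x (EuclideanSpace.single i (1:ℝ))) := by
    intro i
    have := (hi i).continuous_fderiv (by norm_num)
    refine Continuous.integrable_of_hasCompactSupport (by fun_prop) ?_
    exact ((hci i).fderiv_apply (𝕜 := ℝ) _).mul_left
  have I2 : ∀ i, Integrable (fun x => fderiv ℝ w x (EuclideanSpace.single i (1:ℝ)) * φ x i) := by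
    intro i
    have := (hi i).continuous
    refine Continuous.integrable_of_hasCompactSupport (by fun_prop) ?_
    exact (hci i).mul_left
  have I3 : ∀ i, Integrable (fun x => w x * φ x i) := by
    intro i
    have := (hi i).continuous
    refine Continuous.integrable_of_hasCompactSupport (by fun_prop) ?_
    exact (hci i).mul_left
  have e1 : ∀ x, w x * divg φ x
      = ∑ i, w x * fderiv ℝ (fun x => φ x i) x (EuclideanSpace.single i (1:ℝ)) := by
    intro x
    simp [divg, hd, Finset.mul_sum]
  have e2 : ∀ x, fderiv ℝ w x (φ x)
      = ∑ i, fderiv ℝ w x (EuclideanSpace.single i (1:ℝ)) * φ x i := by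
    intro x
    have : φ x = ∑ i, φ x i • EuclideanSpace.single i (1:ℝ) := by
      ext j
      simp [Pi.single_apply]
    conv_lhs => rw [this]
    simp [mul_comm]
  simp_rw [e1, e2]
  rw [integral_finsetSum _ (fun i _ => I1 i), integral_finsetSum _ (fun i _ => I2 i),
    ← Finset.sum_neg_distrib]
  refine Finset.sum_congr rfl fun i _ => ?_
  rw [integral_mul_fderiv_eq_neg_fderiv_mul_of_integrable (I2 i) (I1 i) (I3 i)
    (fun x _ => hw.differentiable (by norm_num) x)
    (fun x _ => (hi i).differentiable (by norm_num) x), neg_neg]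

lemma adm_translate {φ : 𝔼 → 𝔼} (h : Adm φ) (y : 𝔼) : Adm (fun x => φ (x + y)) := by
  refine ⟨h.1.comp (by fun_prop), ?_, fun x => h.2.2 _⟩
  exact h.2.1.comp_homeomorph (Homeomorph.addRight y)

lemma divg_translate (φ : 𝔼 → 𝔼) (y x : 𝔼) :
    divg (fun x => φ (x + y)) x = divg φ (x + y) := by
  unfold divg
  rw [fderiv_comp_add_right]

lemma mollify_le {v : 𝔼 → ℝ} (hv : Integrable v) (hT : TV v < ⊤) (ρ : ContDiffBump (0 : 𝔼))
    {φ : 𝔼 → 𝔼} (h : Adm φ) :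
    -∫ x, (convolution (ρ.normed volume) v (ContinuousLinearMap.lsmul ℝ ℝ) volume) x * divg φ x
      ≤ (TV v).toReal := by
  obtain ⟨C, hC⟩ := (divg_continuous h.1).bounded_above_of_compact_support
    (divg_hasCompactSupport h.2.1)
  have hI := (ρ.integrable_normed (μ := (volume : Measure 𝔼))).convolution_integrand
    (ContinuousLinearMap.lsmul ℝ ℝ) hv
  have hI2 : Integrable (fun p : 𝔼 × 𝔼 =>
      (ContinuousLinearMap.lsmul ℝ ℝ (ρ.normed volume p.2)) (v (p.1 - p.2)) * divg φ p.1)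
      (volume.prod volume) := by
    refine hI.mul_bdd (c := C) ?_ (ae_of_all _ fun p => hC p.1)
    exact ((divg_continuous h.1).comp continuous_fst).aestronglyMeasurable
  have e : ∫ x, (convolution (ρ.normed volume) v (ContinuousLinearMap.lsmul ℝ ℝ) volume) x * divg φ x
      = ∫ y, ρ.normed volume y * ∫ x, v x * divg φ (x + y) := by
    simp_rw [convolution_def, ← integral_mul_const]
    rw [integral_integral_swap hI2]
    congr 1
    ext y
    rw [← integral_const_mul,
      ← integral_sub_right_eq_self (fun x => ρ.normed volume y * (v x * divg φ (x + y))) y]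
    simp [mul_assoc]
  have hI3 : Integrable (fun y => ρ.normed volume y * ∫ x, v x * divg φ (x + y)) := by
    have := hI2.integral_prod_right
    refine this.congr (ae_of_all _ fun y => ?_)
    simp only
    rw [← integral_const_mul,
      ← integral_sub_right_eq_self (fun x => ρ.normed volume y * (v x * divg φ (x + y))) y]
    simp [mul_assoc]
  rw [e, ← integral_neg]
  calc ∫ y, -(ρ.normed volume y * ∫ x, v x * divg φ (x + y))
      ≤ ∫ y, ρ.normed volume y * (TV v).toReal := by
        refine integral_mono hI3.neg (ρ.integrable_normed.mul_const _) fun y => ?_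
        have := le_TV (adm_translate h y) hT
        simp_rw [divg_translate] at this
        have := mul_le_mul_of_nonneg_left this (ρ.nonneg_normed (μ := volume) y)
        simp only
        linarith
    _ = (TV v).toReal := by rw [integral_mul_const, ρ.integral_normed, one_mul]

lemma tendsto_pairing {u : ℕ → 𝔼 → ℝ} {u0 : 𝔼 → ℝ} {φ : 𝔼 → 𝔼} (h : Adm φ) (C : ℝ)
    (hm : ∀ n, AEStronglyMeasurable (u n) volume) (hb : ∀ n x, |u n x| ≤ C)
    (hl : ∀ᵐ x, Tendsto (fun n => u n x) atTop (𝓝 (u0 x))) :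
    Tendsto (fun n => -∫ x, u n x * divg φ x) atTop (𝓝 (-∫ x, u0 x * divg φ x)) := by
  refine Tendsto.neg ?_
  refine tendsto_integral_of_dominated_convergence (fun x => C * |divg φ x|) ?_ ?_ ?_ ?_
  · exact fun n => (hm n).mul (divg_continuous h.1).aestronglyMeasurable
  · exact (divg_integrable h.1 h.2.1).abs.const_mul _
  · intro n
    refine ae_of_all _ fun x => ?_
    rw [Real.norm_eq_abs, abs_mul]
    exact mul_le_mul_of_nonneg_right (hb n x) (abs_nonneg _)
  · filter_upwards [hl] with x hx using hx.mul_const _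

lemma smooth_split {w : 𝔼 → ℝ} (hw : ContDiff ℝ 2 w) {η : ℝ → ℝ} (hη : ContDiff ℝ 2 η)
    (hη' : ∀ x, deriv η x ∈ Set.Icc (0:ℝ) 1)
    {φ₁ φ₂ : 𝔼 → 𝔼} (h1 : Adm φ₁) (h2 : Adm φ₂) :
    ∃ Φ : 𝔼 → 𝔼, Adm Φ ∧
    (-∫ x, η (w x) * divg φ₁ x) + (-∫ x, (w x - η (w x)) * divg φ₂ x)
      = -∫ x, w x * divg Φ x := by
  have hη1 : ContDiff ℝ 1 η := hη.of_le (by norm_num)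
  have hw1 : ContDiff ℝ 1 w := hw.of_le (by norm_num)
  have hdη : ContDiff ℝ 1 (deriv η) := by
    have : ContDiff ℝ (1 + 1) η := by norm_num; exact hη
    exact (contDiff_succ_iff_deriv.1 this).2.2
  let Φ : 𝔼 → 𝔼 := fun x => deriv η (w x) • φ₁ x + (1 - deriv η (w x)) • φ₂ x
  have hΦ : Adm Φ := by
    refine ⟨?_, ?_, fun x => ?_⟩
    · have : ContDiff ℝ 1 (fun x => deriv η (w x)) := hdη.comp hw1
      have a := h1.1
      have b := h2.1
      exact (this.smul a).add ((contDiff_const.sub this).smul b)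
    · exact HasCompactSupport.add (h1.2.1.smul_left (f := fun x => deriv η (w x)))
        (h2.2.1.smul_left (f := fun x => 1 - deriv η (w x)))
    · have a := hη' (w x)
      calc ‖Φ x‖ ≤ ‖deriv η (w x) • φ₁ x‖ + ‖(1 - deriv η (w x)) • φ₂ x‖ := norm_add_le _ _
        _ = deriv η (w x) * ‖φ₁ x‖ + (1 - deriv η (w x)) * ‖φ₂ x‖ := by
          rw [norm_smul, norm_smul, Real.norm_of_nonneg a.1,
            Real.norm_of_nonneg (sub_nonneg.2 a.2)]
        _ ≤ deriv η (w x) * 1 + (1 - deriv η (w x)) * 1 := by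
          gcongr
          · exact a.1
          · exact h1.2.2 x
          · exact sub_nonneg.2 a.2
          · exact h2.2.2 x
        _ = 1 := by ring
  refine ⟨Φ, hΦ, ?_⟩
  have hηw : ContDiff ℝ 1 (fun x => η (w x)) := hη1.comp hw1
  have hfd : ∀ x, HasFDerivAt (fun x => η (w x)) (deriv η (w x) • fderiv ℝ w x) x := by
    intro x
    exact ((hη1.differentiable (by norm_num) _).hasDerivAt).comp_hasFDerivAt x
      (hw1.differentiable (by norm_num) x).hasFDerivAt
  rw [ibp hηw h1.1 h1.2.1, ibp (hw1.sub hηw) h2.1 h2.2.1, ibp hw1 hΦ.1 hΦ.2.1, ← integral_add]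
  · congr 1
    ext x
    have := (hw1.differentiable (by norm_num) x).hasFDerivAt
    have h3 : HasFDerivAt (fun x => w x - η (w x))
      (fderiv ℝ w x - deriv η (w x) • fderiv ℝ w x) x := this.sub (hfd x)
    rw [(hfd x).fderiv, h3.fderiv]
    simp [Φ]
    ring
  · have a := hηw.continuous_fderiv (by norm_num)
    have b := h1.1.continuous
    refine Continuous.integrable_of_hasCompactSupport (by fun_prop) (h1.2.1.mono ?_)
    intro x hx h0
    exact hx (by simp [h0])
  · have a := (hw1.sub hηw).continuous_fderiv (by norm_num)
    have b := h2.1.continuous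
    refine Continuous.integrable_of_hasCompactSupport (by fun_prop) (h2.2.1.mono ?_)
    intro x hx h0
    exact hx (by simp [h0])

lemma splitting {v : 𝔼 → ℝ} (hv : Integrable v) (h01 : ∀ x, v x ∈ Set.Icc (0:ℝ) 1)
    (hT : TV v < ⊤) {η : ℝ → ℝ} (hη : ContDiff ℝ 2 η) (hη' : ∀ x, deriv η x ∈ Set.Icc (0:ℝ) 1)
    {φ₁ φ₂ : 𝔼 → 𝔼} (h1 : Adm φ₁) (h2 : Adm φ₂) :
    (-∫ x, η (v x) * divg φ₁ x) + (-∫ x, (v x - η (v x)) * divg φ₂ x) ≤ (TV v).toReal := by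
  let ρ : ℕ → ContDiffBump (0 : 𝔼) := fun n =>
    ⟨1 / ((n:ℝ) + 1), 2 * (1 / ((n:ℝ) + 1)), by positivity, by
      have : 0 < 1 / ((n:ℝ) + 1) := by positivity
      linarith⟩
  let w : ℕ → 𝔼 → ℝ := fun n =>
    convolution ((ρ n).normed volume) v (ContinuousLinearMap.lsmul ℝ ℝ) volume
  have hlim : ∀ᵐ x, Tendsto (fun n => w n x) atTop (𝓝 (v x)) := by
    refine ContDiffBump.ae_convolution_tendsto_right_of_locallyIntegrable (K := 2) ?_ ?_
      hv.locallyIntegrable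
    · have := (tendsto_one_div_add_atTop_nhds_zero_nat (𝕜 := ℝ)).const_mul 2
      simpa [ρ] using this
    · exact Eventually.of_forall fun n => le_rfl
  have hws : ∀ n, ContDiff ℝ 2 (w n) := fun n =>
    (ρ n).hasCompactSupport_normed.contDiff_convolution_left _
      ((ρ n).contDiff_normed (n := 2)) hv.locallyIntegrable
  have hw01 : ∀ n x, w n x ∈ Set.Icc (0:ℝ) 1 := by
    intro n x
    have hn := (ρ n).nonneg_normed (μ := (volume : Measure 𝔼))
    simp only [w, convolution_def, ContinuousLinearMap.lsmul_apply, smul_eq_mul]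
    refine ⟨integral_nonneg fun y => mul_nonneg (hn y) (h01 _).1, ?_⟩
    rw [← (ρ n).integral_normed (μ := (volume : Measure 𝔼))]
    refine integral_mono_of_nonneg (ae_of_all _ fun y => mul_nonneg (hn y) (h01 _).1)
      (ρ n).integrable_normed (ae_of_all _ fun y => ?_)
    exact mul_le_of_le_one_right (hn y) (h01 _).2
  obtain ⟨C, hC⟩ := (isCompact_Icc (a := (0:ℝ)) (b := 1)).exists_bound_of_continuousOn
    hη.continuous.continuousOn
  have hηc := hη.continuous
  have T1 := tendsto_pairing (u := fun n x => η (w n x)) (u0 := fun x => η (v x)) h1 C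
    (fun n => (hηc.comp (hws n).continuous).aestronglyMeasurable) (fun n x => hC _ (hw01 n x))
    (by filter_upwards [hlim] with x hx using (hηc.tendsto _).comp hx)
  have T2 := tendsto_pairing (u := fun n x => w n x - η (w n x)) (u0 := fun x => v x - η (v x)) h2
    (1 + C)
    (fun n => ((hws n).continuous.sub (hηc.comp (hws n).continuous)).aestronglyMeasurable)
    (fun n x => by
      refine (abs_sub _ _).trans (add_le_add ?_ (hC _ (hw01 n x)))
      rw [abs_of_nonneg (hw01 n x).1]
      exact (hw01 n x).2)
    (by filter_upwards [hlim] with x hx using hx.sub ((hηc.tendsto _).comp hx))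
  refine le_of_tendsto' (T1.add T2) fun n => ?_
  obtain ⟨Φ, hΦ, e⟩ := smooth_split (hws n) hη hη' h1 h2
  exact e.le.trans (mollify_le hv hT (ρ n) hΦ)

lemma TV_toReal_le {u : 𝔼 → ℝ} {C : ℝ} (h : ∀ φ : 𝔼 → 𝔼, Adm φ → -∫ x, u x * divg φ x ≤ C) :
    TV u < ⊤ ∧ (TV u).toReal ≤ C := by
  have hC : 0 ≤ C := by
    have := h _ adm_zero
    simpa [divg_zero] using this
  have h1 := TV_le h
  exact ⟨h1.trans_lt ENNReal.ofReal_lt_top, ENNReal.toReal_le_of_le_ofReal hC h1⟩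

lemma energy_le {s : 𝔼 → ℝ} (hsi : Integrable s) {α : ℝ} (hα : 0 < α)
    {v : 𝔼 → ℝ} (hv : Integrable v) (h01 : ∀ x, v x ∈ Set.Icc (0:ℝ) 1) (hT : TV v < ⊤)
    (hmin : ∀ u ∈ Kadm, Erelax s α v ≤ Erelax s α u)
    {η : ℝ → ℝ} (hη : ContDiff ℝ 2 η) (hη' : ∀ x, deriv η x ∈ Set.Icc (0:ℝ) 1)
    {c : ℝ} (hc0 : 0 < c) (hc1 : c < 1) (e0 : η 0 = 0) (e1 : η 1 = c) :
    TV (fun x => c⁻¹ * η (v x)) < ⊤ ∧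
      Erelax s α (fun x => c⁻¹ * η (v x)) ≤ Erelax s α v := by
  have hd : Differentiable ℝ η := hη.differentiable (by norm_num)
  have m1 : Monotone η := monotone_of_deriv_nonneg hd fun x => (hη' x).1
  have m2 : Monotone (fun x => x - η x) := by
    refine monotone_of_deriv_nonneg (differentiable_id.sub hd) fun x => ?_
    have : HasDerivAt (fun x => x - η x) (1 - deriv η x) x :=
      (hasDerivAt_id x).sub (hd x).hasDerivAt
    rw [this.deriv]
    exact sub_nonneg.2 (hη' x).2
  have b1 : ∀ x, 0 ≤ η (v x) := fun x => e0 ▸ m1 (h01 x).1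
  have b2 : ∀ x, η (v x) ≤ c := fun x => e1 ▸ m1 (h01 x).2
  have b3 : ∀ x, 0 ≤ v x - η (v x) := fun x => by
    have := m2 (h01 x).1
    simpa [e0] using this
  have b4 : ∀ x, v x - η (v x) ≤ 1 - c := fun x => by
    have := m2 (h01 x).2
    simpa [e1] using this
  have hc2 : 0 < 1 - c := by linarith
  have hηm : AEStronglyMeasurable (fun x => η (v x)) volume :=
    hη.continuous.comp_aestronglyMeasurable hv.1
  have hηi : Integrable (fun x => η (v x)) := by
    refine hv.mono' hηm (ae_of_all _ fun x => ?_)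
    rw [Real.norm_of_nonneg (b1 x)]
    linarith [b3 x]
  set F : 𝔼 → ℝ := fun x => c⁻¹ * η (v x) with hF
  set G : 𝔼 → ℝ := fun x => (1 - c)⁻¹ * (v x - η (v x)) with hG
  have pF : ∀ g : 𝔼 → ℝ, ∫ x, η (v x) * g x = c * ∫ x, F x * g x := by
    intro g
    rw [← integral_const_mul]
    congr 1
    ext x
    simp only [hF]
    field_simp
  have pG : ∀ g : 𝔼 → ℝ, ∫ x, (v x - η (v x)) * g x = (1 - c) * ∫ x, G x * g x := by
    intro g
    rw [← integral_const_mul]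
    congr 1
    ext x
    simp only [hG]
    field_simp
  set T := (TV v).toReal
  have sp : ∀ φ₁ φ₂ : 𝔼 → 𝔼, Adm φ₁ → Adm φ₂ →
      c * (-∫ x, F x * divg φ₁ x) + (1 - c) * (-∫ x, G x * divg φ₂ x) ≤ T := by
    intro φ₁ φ₂ h1 h2
    have := splitting hv h01 hT hη hη' h1 h2
    rw [pF, pG] at this
    linarith
  have A : ∀ φ₂ : 𝔼 → 𝔼, Adm φ₂ → TV F < ⊤ ∧
      (TV F).toReal ≤ (T - (1 - c) * (-∫ x, G x * divg φ₂ x)) / c := by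
    intro φ₂ h2
    refine TV_toReal_le fun φ₁ h1 => ?_
    rw [le_div_iff₀ hc0]
    linarith [sp φ₁ φ₂ h1 h2]
  have hTF := (A _ adm_zero).1
  have B : TV G < ⊤ ∧ (TV G).toReal ≤ (T - c * (TV F).toReal) / (1 - c) := by
    refine TV_toReal_le fun φ₂ h2 => ?_
    have := (A φ₂ h2).2
    rw [le_div_iff₀ hc0] at this
    rw [le_div_iff₀ hc2]
    linarith
  have B2 := B.2
  rw [le_div_iff₀ hc2] at B2
  have hGK : G ∈ Kadm := by
    refine ⟨(hv.sub hηi).const_mul _, ae_of_all _ fun x => ⟨?_, ?_⟩, B.1⟩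
    · exact mul_nonneg (inv_nonneg.2 hc2.le) (b3 x)
    · exact (inv_mul_le_one₀ hc2).2 (b4 x)
  refine ⟨hTF, ?_⟩
  have hm := hmin G hGK
  have I1 : Integrable (fun x => η (v x) * s x) := by
    refine hsi.bdd_mul (c := c) hηm (ae_of_all _ fun x => ?_)
    rw [Real.norm_of_nonneg (b1 x)]
    exact b2 x
  have I2 : Integrable (fun x => (v x - η (v x)) * s x) := by
    refine hsi.bdd_mul (c := 1 - c) (hv.1.sub hηm) (ae_of_all _ fun x => ?_)
    rw [Real.norm_of_nonneg (b3 x)]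
    exact b4 x
  have es : ∫ x, v x * s x = c * (∫ x, F x * s x) + (1 - c) * ∫ x, G x * s x := by
    rw [← pF, ← pG, ← integral_add I1 I2]
    congr 1
    ext x
    ring
  unfold Erelax at hm ⊢
  change (∫ x, v x * s x) + α * T ≤ _ at hm
  change _ ≤ (∫ x, v x * s x) + α * T
  have B3 := mul_le_mul_of_nonneg_left B2 hα.le
  have hm2 := mul_le_mul_of_nonneg_left hm hc2.le
  refine le_of_mul_le_mul_left ?_ hc0
  rw [es] at hm2 ⊢
  nlinarith

lemma deriv_smoothTransition_bdd : ∃ M : ℝ, ∀ x, deriv Real.smoothTransition x ≤ M := by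
  have hd : Continuous (deriv Real.smoothTransition) :=
    (Real.smoothTransition.contDiff (n := 1)).continuous_deriv (by norm_num)
  obtain ⟨C, hC⟩ := (isCompact_Icc (a := (0:ℝ)) (b := 1)).exists_bound_of_continuousOn
    hd.continuousOn
  have hC0 : 0 ≤ C := (norm_nonneg _).trans (hC 0 (by simp))
  refine ⟨C, fun x => ?_⟩
  rcases lt_or_ge x 0 with h | h
  · have : Real.smoothTransition =ᶠ[𝓝 x] fun _ => 0 := by
      filter_upwards [Iio_mem_nhds h] with y hy
      exact Real.smoothTransition.zero_of_nonpos (le_of_lt hy)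
    rw [this.deriv_eq]
    simpa using hC0
  rcases lt_or_ge 1 x with h' | h'
  · have : Real.smoothTransition =ᶠ[𝓝 x] fun _ => 1 := by
      filter_upwards [Ioi_mem_nhds h'] with y hy
      exact Real.smoothTransition.one_of_one_le (le_of_lt hy)
    rw [this.deriv_eq]
    simpa using hC0
  · exact (le_abs_self _).trans (hC x ⟨h, h'⟩)

lemma step_energy {s : 𝔼 → ℝ} (hsi : Integrable s) {α : ℝ} (hα : 0 < α)
    {v : 𝔼 → ℝ} (hv : Integrable v) (h01 : ∀ x, v x ∈ Set.Icc (0:ℝ) 1) (hT : TV v < ⊤)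
    (hmin : ∀ u ∈ Kadm, Erelax s α v ≤ Erelax s α u)
    {t a : ℝ} (ht : 0 ≤ t) (ha : 0 < a) (hat : 1 ≤ a * (1 - t)) :
    TV (fun x => Real.smoothTransition (a * (v x - t))) < ⊤ ∧
      Erelax s α (fun x => Real.smoothTransition (a * (v x - t))) ≤ Erelax s α v := by
  obtain ⟨M, hM⟩ := deriv_smoothTransition_bdd
  have hst : ContDiff ℝ 2 Real.smoothTransition := Real.smoothTransition.contDiff (n := 2)
  have hM0 : 0 ≤ M := Real.smoothTransition.monotone.deriv_nonneg.trans (hM 0)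
  have hp : 0 < M * a + 2 := by positivity
  set c : ℝ := (M * a + 2)⁻¹ with hc
  have hc0 : 0 < c := inv_pos.2 hp
  have hc1 : c < 1 := inv_lt_one_of_one_lt₀ (by nlinarith [mul_nonneg hM0 ha.le])
  have key := energy_le hsi hα hv h01 hT hmin
    (η := fun x => c * Real.smoothTransition (a * (x - t))) (c := c) ?_ ?_ hc0 hc1 ?_ ?_
  · have e : (fun x => c⁻¹ * (c * Real.smoothTransition (a * (v x - t))))
        = fun x => Real.smoothTransition (a * (v x - t)) := by
      ext x
      field_simp
    simpa only [e] using key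
  · exact contDiff_const.mul (hst.comp (by fun_prop))
  · intro x
    have h1 : HasDerivAt (fun x => a * (x - t)) (a * 1) x :=
      ((hasDerivAt_id x).sub_const t).const_mul a
    have h2 := (((hst.differentiable (by norm_num)) (a * (x - t))).hasDerivAt.comp x h1).const_mul c
    have h3 : deriv (fun x => c * Real.smoothTransition (a * (x - t))) x
      = c * (deriv Real.smoothTransition (a * (x - t)) * (a * 1)) := h2.deriv
    rw [h3]
    have h4 : 0 ≤ deriv Real.smoothTransition (a * (x - t)) :=
      Real.smoothTransition.monotone.deriv_nonneg
    refine ⟨by positivity, ?_⟩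
    rw [hc, inv_mul_le_iff₀ hp]
    nlinarith [mul_le_mul_of_nonneg_right (hM (a * (x - t))) ha.le]
  · rw [Real.smoothTransition.zero_of_nonpos (by nlinarith), mul_zero]
  · rw [Real.smoothTransition.one_of_one_le hat, mul_one]

lemma threshold {s : 𝔼 → ℝ} (hsi : Integrable s) {α : ℝ} (hα : 0 < α)
    {v : 𝔼 → ℝ} (hv : Integrable v) (h01 : ∀ x, v x ∈ Set.Icc (0:ℝ) 1) (hT : TV v < ⊤)
    (hmin : ∀ u ∈ Kadm, Erelax s α v ≤ Erelax s α u)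
    {t : ℝ} (ht : t ∈ Set.Ioo (0:ℝ) 1) :
    Set.indicator {x | t < v x} (fun _ => (1:ℝ)) ∈ Kadm ∧
    Erelax s α (Set.indicator {x | t < v x} (fun _ => (1:ℝ))) ≤ Erelax s α v := by
  have ht1 : 0 < 1 - t := sub_pos.2 ht.2
  let a : ℕ → ℝ := fun n => ((n:ℝ) + 1) / (1 - t)
  have ha : ∀ n, 0 < a n := fun n => by positivity
  have hat : ∀ n, 1 ≤ a n * (1 - t) := fun n => by
    simp only [a]
    rw [div_mul_cancel₀ _ ht1.ne']
    linarith [Nat.cast_nonneg (α := ℝ) n]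
  let u : ℕ → 𝔼 → ℝ := fun n x => Real.smoothTransition (a n * (v x - t))
  set χ : 𝔼 → ℝ := Set.indicator {x | t < v x} (fun _ => (1:ℝ)) with hχ
  have hE : ∀ n, TV (u n) < ⊤ ∧ Erelax s α (u n) ≤ Erelax s α v := fun n =>
    step_energy hsi hα hv h01 hT hmin ht.1.le (ha n) (hat n)
  have hum : ∀ n, AEStronglyMeasurable (u n) volume := fun n => by
    have : Continuous (fun y : ℝ => Real.smoothTransition (a n * (y - t))) :=
      Real.smoothTransition.continuous.comp (by fun_prop)
    exact this.comp_aestronglyMeasurable hv.1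
  have hub : ∀ n x, |u n x| ≤ 1 := fun n x => by
    rw [abs_of_nonneg (Real.smoothTransition.nonneg _)]
    exact Real.smoothTransition.le_one _
  have hlim : ∀ x, Tendsto (fun n => u n x) atTop (𝓝 (χ x)) := by
    intro x
    by_cases hx : t < v x
    · have h1 : χ x = 1 := by simp [hχ, hx]
      rw [h1]
      have h2 : Tendsto (fun n => a n * (v x - t)) atTop atTop := by
        refine Tendsto.atTop_mul_const (sub_pos.2 hx) ?_
        refine Tendsto.atTop_div_const ht1 ?_
        exact tendsto_atTop_add_const_right _ _ tendsto_natCast_atTop_atTop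
      refine tendsto_const_nhds.congr' ?_
      filter_upwards [h2.eventually_ge_atTop 1] with n hn
      exact (Real.smoothTransition.one_of_one_le hn).symm
    · have h1 : χ x = 0 := by simp [hχ, hx]
      rw [h1]
      refine tendsto_const_nhds.congr fun n => ?_
      exact (Real.smoothTransition.zero_of_nonpos
        (mul_nonpos_of_nonneg_of_nonpos (ha n).le (by linarith [not_lt.1 hx]))).symm
  have hχm : AEStronglyMeasurable χ volume :=
    aestronglyMeasurable_of_tendsto_ae atTop hum (ae_of_all _ hlim)
  have hχ01 : ∀ x, χ x ∈ Set.Icc (0:ℝ) 1 := fun x => by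
    by_cases hx : t < v x <;> simp [hχ, hx]
  have hχi : Integrable χ := by
    refine (hv.const_mul t⁻¹).mono' hχm (ae_of_all _ fun x => ?_)
    rw [Real.norm_of_nonneg (hχ01 x).1]
    by_cases hx : t < v x
    · have h1 : χ x = 1 := by simp [hχ, hx]
      rw [h1, ← div_eq_inv_mul, one_le_div ht.1]
      exact hx.le
    · have h1 : χ x = 0 := by simp [hχ, hx]
      rw [h1]
      exact mul_nonneg (inv_nonneg.2 ht.1.le) (h01 x).1
  have hs : Tendsto (fun n => ∫ x, u n x * s x) atTop (𝓝 (∫ x, χ x * s x)) := by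
    refine tendsto_integral_of_dominated_convergence (fun x => |s x|) ?_ hsi.abs ?_ ?_
    · exact fun n => (hum n).mul hsi.1
    · intro n
      refine ae_of_all _ fun x => ?_
      rw [Real.norm_eq_abs, abs_mul]
      exact mul_le_of_le_one_left (abs_nonneg _) (hub n x)
    · exact ae_of_all _ fun x => (hlim x).mul_const _
  have hTV := TV_toReal_le (u := χ) (C := (Erelax s α v - ∫ x, χ x * s x) / α) (by
    intro φ hφ
    refine le_of_tendsto_of_tendsto' (tendsto_pairing hφ 1 hum hub (ae_of_all _ hlim))
      ((hs.const_sub (Erelax s α v)).div_const α) fun n => ?_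
    rw [le_div_iff₀ hα]
    have h1 := (hE n).2
    have h2 := mul_le_mul_of_nonneg_left (le_TV hφ (hE n).1) hα.le
    have h3 : Erelax s α (u n) = (∫ x, u n x * s x) + α * (TV (u n)).toReal := rfl
    linarith)
  refine ⟨⟨hχi, ae_of_all _ hχ01, hTV.1⟩, ?_⟩
  have h2 := hTV.2
  rw [le_div_iff₀ hα] at h2
  have h3 : Erelax s α χ = (∫ x, χ x * s x) + α * (TV χ).toReal := rfl
  linarith

lemma TV_congr {u v : 𝔼 → ℝ} (h : u =ᵐ[volume] v) : TV u = TV v := by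
  unfold TV
  congr 1
  ext φ
  congr 2
  exact integral_congr_ae (by filter_upwards [h] with x hx; rw [hx])

lemma Erelax_congr {s : 𝔼 → ℝ} {α : ℝ} {u v : 𝔼 → ℝ} (h : u =ᵐ[volume] v) :
    Erelax s α u = Erelax s α v := by
  unfold Erelax
  rw [TV_congr h]
  congr 1
  exact integral_congr_ae (by filter_upwards [h] with x hx; rw [hx])

end TVproof

/-- the thresholding theorem. If `v* ∈ K` minimizes
`E(v) = ∫ v·s + α·TV(v)` over `K`, then for almost every `t ∈ (0,1)` the indicator
of the super-level set `{v* > t}` belongs to `K` and also minimizes `E` over `K`;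
in particular it minimizes `E` among all `{0,1}`-valued functions in `K`. -/
theorem stmt3 {d : ℕ} (s : EuclideanSpace ℝ (Fin d) → ℝ)
    (hsm : Measurable s) (hsb : ∃ C : ℝ, ∀ x, |s x| ≤ C) (hsi : Integrable s)
    (α : ℝ) (hα : 0 < α)
    (vstar : EuclideanSpace ℝ (Fin d) → ℝ)
    (hvK : vstar ∈ Kadm)
    (hvmin : ∀ v ∈ Kadm, Erelax s α vstar ≤ Erelax s α v) :
    ∀ᵐ t ∂(volume.restrict (Set.Ioo (0:ℝ) 1)),
      (Set.indicator {x | t < vstar x} (fun _ => (1:ℝ)) ∈ Kadm) ∧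
      (∀ v ∈ Kadm,
        Erelax s α (Set.indicator {x | t < vstar x} (fun _ => (1:ℝ))) ≤ Erelax s α v) ∧
      (∀ v ∈ Kadm, (∀ x, v x = 0 ∨ v x = 1) →
        Erelax s α (Set.indicator {x | t < vstar x} (fun _ => (1:ℝ))) ≤ Erelax s α v) := by
  rw [ae_restrict_iff' measurableSet_Ioo]
  refine ae_of_all _ fun t ht => ?_
  obtain ⟨hv, h01, hT⟩ := hvK
  let v : EuclideanSpace ℝ (Fin d) → ℝ := fun x => max 0 (min (vstar x) 1)
  have hvv : vstar =ᵐ[volume] v := by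
    filter_upwards [h01] with x hx
    simp [v, min_eq_left hx.2, max_eq_right hx.1]
  have hset : {x | t < vstar x} = {x | t < v x} := by
    ext x
    simp [v, ht.2, ht.1.le, not_lt]
  have key := threshold hsi hα (v := v) (hv.congr hvv)
    (fun x => ⟨le_max_left _ _, max_le zero_le_one (min_le_right _ _)⟩)
    (TV_congr hvv ▸ hT) (fun u hu => (Erelax_congr hvv) ▸ hvmin u hu) ht
  rw [← hset, ← Erelax_congr hvv] at key
  exact ⟨key.1, fun u hu => key.2.trans (hvmin u hu), fun u hu _ => key.2.trans (hvmin u hu)⟩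
end

section
/- Let H be a real Hilbert space and J : H → ℝ a convex, positively one-homogeneous, nonnegative function. Suppose f ∈ H, λ > 0 and λ·f ∈ ∂J(f), where ∂J(u) = { p ∈ H : ∀ v, J(v) ≥ J(u) + ⟨p, v − u⟩ }. Then for every α > 0, the unique minimizer of the ROF-type functional u ↦ (1/2)‖u − f‖² + α·J(u) over H is u* = max(1 − α·λ, 0)·f. In particular, eigenfunctions of J lose contrast but keep their shape under variational regularization with J. -/
open scoped RealInnerProductSpace

/-- The subdifferential of `J : H → ℝ` at `u`. -/
def subdiff {H : Type*} [NormedAddCommGroup H] [InnerProductSpace ℝ H]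
    (J : H → ℝ) (u : H) : Set H :=
  {p | ∀ v, J u + ⟪p, v - u⟫ ≤ J v}

/-- If `J` is convex, positively one-homogeneous and nonnegative on a real
Hilbert space, `λ > 0` and `λ·f ∈ ∂J(f)`, then for every `α > 0` the unique minimizer of
`u ↦ (1/2)‖u − f‖² + α·J(u)` is `u* = max(1 − αλ, 0)·f`. -/
theorem stmt8 {H : Type*} [NormedAddCommGroup H] [InnerProductSpace ℝ H] [CompleteSpace H]
    (J : H → ℝ) (hconv : ConvexOn ℝ Set.univ J)
    (hhom : ∀ c : ℝ, 0 ≤ c → ∀ u : H, J (c • u) = c * J u)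
    (hnonneg : ∀ u, 0 ≤ J u)
    (f : H) (lam : ℝ) (hlam : 0 < lam) (heig : lam • f ∈ subdiff J f) :
    ∀ α : ℝ, 0 < α →
      (∀ u : H,
        (1/2) * ‖(max (1 - α * lam) 0) • f - f‖^2 + α * J ((max (1 - α * lam) 0) • f)
          ≤ (1/2) * ‖u - f‖^2 + α * J u) ∧
      (∀ u : H, (∀ v : H, (1/2) * ‖u - f‖^2 + α * J u ≤ (1/2) * ‖v - f‖^2 + α * J v) →
        u = (max (1 - α * lam) 0) • f) := by
  have hsub : ∀ v, J f + lam * (⟪f, v⟫ - ⟪f, f⟫) ≤ J v := by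
    intro v
    have h := heig v
    rwa [real_inner_smul_left, inner_sub_right] at h
  have h0 := hsub ((0 : ℝ) • f)
  have h2 := hsub ((2 : ℝ) • f)
  rw [hhom 0 le_rfl, inner_smul_right] at h0
  rw [hhom 2 (by norm_num), inner_smul_right] at h2
  have hJf : J f = lam * ⟪f, f⟫ := by linarith
  have hJ : ∀ v, lam * ⟪f, v⟫ ≤ J v := by
    intro v
    have := hsub v
    linarith
  intro α hα
  have key : ∀ u : H,
      (1/2) * ‖(max (1 - α * lam) 0) • f - f‖^2 + α * J ((max (1 - α * lam) 0) • f)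
        + (1/2) * ‖u - (max (1 - α * lam) 0) • f‖^2 ≤ (1/2) * ‖u - f‖^2 + α * J u := by
    intro u
    have hu := mul_le_mul_of_nonneg_left (hJ u) hα.le
    have hu0 := mul_nonneg hα.le (hnonneg u)
    rw [hhom _ (le_max_right _ _), hJf]
    simp only [← real_inner_self_eq_norm_sq, inner_sub_left, inner_sub_right,
      real_inner_smul_left, inner_smul_right, real_inner_comm f u]
    rw [real_inner_comm u f] at *
    rcases le_total (1 - α * lam) 0 with h | h
    · rw [max_eq_right h]
      have : ⟪u, f⟫ ≤ α * J u := by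
        rcases le_total ⟪u, f⟫ 0 with hs | hs
        · linarith
        · nlinarith
      linarith
    · rw [max_eq_left h]
      nlinarith
  refine ⟨fun u => ?_, fun u hu => ?_⟩
  · have := key u
    nlinarith [sq_nonneg ‖u - (max (1 - α * lam) 0) • f‖]
  · have h1 := key u
    have h3 := hu ((max (1 - α * lam) 0) • f)
    have h4 : ‖u - (max (1 - α * lam) 0) • f‖ = 0 := by
      apply pow_eq_zero_iff (two_ne_zero) |>.1
      exact le_antisymm (by linarith) (sq_nonneg _)
    exact sub_eq_zero.1 (norm_eq_zero.1 h4)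
end

section
/- Let H be a real Hilbert space, J : H → ℝ convex, positively one-homogeneous and nonnegative, and let f ∈ H, λ > 0 with λ·f ∈ ∂J(f), where ∂J(u) = { p ∈ H : ∀ v, J(v) ≥ J(u) + ⟨p, v − u⟩ }. Fix α > 0 and define the Bregman iteration: u₀ = 0, p₀ = 0, u_{k+1} = the unique minimizer over H of u ↦ (1/2)‖u − f‖² + α·(J(u) − ⟨p_k, u⟩), and p_{k+1} = p_k + (1/α)(f − u_{k+1}). Then for every k ≥ 0, u_k = min(1, max(0, k − α·λ))·f and p_k = min(k/α, λ)·f; in particular p_k ∈ ∂J(u_k) for all k, u_k = 0 for k ≤ α·λ, and u_k = f for all k ≥ α·λ + 1, so the inverse scale space Bregman iteration restores the eigenfunction f exactly (including its full contrast) after finitely many steps. -/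
open scoped RealInnerProductSpace

theorem aux_unique {H : Type*} [NormedAddCommGroup H] [InnerProductSpace ℝ H]
    (J : H → ℝ) (f : H) (α : ℝ) (hα : 0 < α) (w d p : H)
    (hmin : (1/2) * ‖w - f‖^2 + α * (J w - ⟪p, w⟫) ≤ (1/2) * ‖d - f‖^2 + α * (J d - ⟪p, d⟫))
    (hq : p + α⁻¹ • (f - d) ∈ subdiff J d) : w = d := by
  have h1 := hq w
  have h2 : ‖w - f‖^2 = ‖w - d‖^2 - 2 * ⟪f - d, w - d⟫ + ‖d - f‖^2 := by
    have : w - f = (w - d) - (f - d) := by abel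
    rw [this, norm_sub_sq_real, real_inner_comm, norm_sub_rev d f]
  have h3 : α * (J d + ⟪p + α⁻¹ • (f - d), w - d⟫) ≤ α * J w :=
    mul_le_mul_of_nonneg_left h1 hα.le
  rw [inner_add_left, real_inner_smul_left, mul_add, mul_add, ← mul_assoc α α⁻¹,
    mul_inv_cancel₀ hα.ne', one_mul, inner_sub_right p] at h3
  rw [h2] at hmin
  have h4 : ‖w - d‖^2 ≤ 0 := by nlinarith
  have h5 : ‖w - d‖ = 0 := by
    have := sq_nonneg ‖w - d‖
    exact pow_eq_zero_iff (two_ne_zero) |>.1 (le_antisymm h4 this)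
  exact sub_eq_zero.1 (norm_eq_zero.1 h5)

theorem aux_real (x L : ℝ) :
    min x L + (1 - min 1 (max 0 (x + 1 - L))) = min (x + 1) L := by
  rcases le_total x L with h | h
  · rcases le_total (x + 1) L with h' | h'
    · rw [min_eq_left h, min_eq_left h', max_eq_left (by linarith), min_eq_right (by norm_num)]
      ring
    · rw [min_eq_left h, min_eq_right h', max_eq_right (by linarith), min_eq_right (by linarith)]
      ring
  · rw [min_eq_right h, min_eq_right (a := x + 1) (by linarith), max_eq_right (by linarith),
      min_eq_left (by linarith)]
    ring

theorem aux_sub {H : Type*} [NormedAddCommGroup H] [InnerProductSpace ℝ H]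
    (J : H → ℝ)
    (hhom : ∀ c : ℝ, 0 ≤ c → ∀ u : H, J (c • u) = c * J u)
    (hnonneg : ∀ u, 0 ≤ J u)
    (f : H) (lam : ℝ) (heig : lam • f ∈ subdiff J f)
    (c m : ℝ) (hc : 0 ≤ c) (hm : 0 ≤ m) (hml : m ≤ lam) (hcm : c * (lam - m) = 0) :
    m • f ∈ subdiff J (c • f) := by
  have h0 : J 0 = 0 := by simpa using hhom 0 le_rfl 0
  have e1 := heig 0
  have e2 := heig ((2 : ℝ) • f)
  rw [hhom 2 (by norm_num)] at e2
  have t : (2 : ℝ) • f - f = f := by rw [two_smul]; abel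
  rw [t, real_inner_smul_left] at e2
  rw [h0, zero_sub, inner_neg_right, real_inner_smul_left] at e1
  have hJ : J f = lam * ⟪f, f⟫ := by linarith
  intro v
  have e3 := heig v
  rw [real_inner_smul_left, inner_sub_right, hJ] at e3
  rw [hhom c hc, real_inner_smul_left, inner_sub_right, real_inner_smul_right, hJ]
  have e4 : c * (lam * ⟪f, f⟫) + m * (⟪f, v⟫ - c * ⟪f, f⟫) = m * ⟪f, v⟫ := by
    linear_combination ⟪f, f⟫ * hcm
  rw [e4]
  rcases le_total 0 ⟪f, v⟫ with h | h
  · nlinarith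
  · nlinarith [hnonneg v]

/-- For an eigenfunction `λ·f ∈ ∂J(f)` (`J` convex, positively
one-homogeneous, nonnegative, on a real Hilbert space) and the Bregman iteration
`u₀ = 0`, `p₀ = 0`, `u_{k+1}` minimizing `u ↦ (1/2)‖u − f‖² + α(J(u) − ⟪p_k, u⟫)`,
`p_{k+1} = p_k + (1/α)(f − u_{k+1})`, one has
`u_k = min(1, max(0, k − αλ))·f` and `p_k = min(k/α, λ)·f` for all `k`; in particular
`p_k ∈ ∂J(u_k)`, `u_k = 0` for `k ≤ αλ`, and `u_k = f` for `k ≥ αλ + 1`. -/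
theorem stmt9 {H : Type*} [NormedAddCommGroup H] [InnerProductSpace ℝ H] [CompleteSpace H]
    (J : H → ℝ) (hconv : ConvexOn ℝ Set.univ J)
    (hhom : ∀ c : ℝ, 0 ≤ c → ∀ u : H, J (c • u) = c * J u)
    (hnonneg : ∀ u, 0 ≤ J u)
    (f : H) (lam : ℝ) (hlam : 0 < lam) (heig : lam • f ∈ subdiff J f)
    (α : ℝ) (hα : 0 < α)
    (u p : ℕ → H) (hu0 : u 0 = 0) (hp0 : p 0 = 0)
    (hmin : ∀ k, ∀ v : H,
      (1/2) * ‖u (k+1) - f‖^2 + α * (J (u (k+1)) - ⟪p k, u (k+1)⟫)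
        ≤ (1/2) * ‖v - f‖^2 + α * (J v - ⟪p k, v⟫))
    (hpupd : ∀ k, p (k+1) = p k + α⁻¹ • (f - u (k+1))) :
    ∀ k : ℕ,
      u k = (min 1 (max 0 ((k : ℝ) - α * lam))) • f ∧
      p k = (min ((k : ℝ) / α) lam) • f ∧
      p k ∈ subdiff J (u k) ∧
      ((k : ℝ) ≤ α * lam → u k = 0) ∧
      (α * lam + 1 ≤ (k : ℝ) → u k = f) := by
  have hcoef : ∀ k : ℕ, (min ((k : ℝ) / α) lam) • f ∈
      subdiff J ((min 1 (max 0 ((k : ℝ) - α * lam))) • f) := by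
    intro k
    apply aux_sub J hhom hnonneg f lam heig
    · exact le_min zero_le_one (le_max_left _ _)
    · exact le_min (by positivity) hlam.le
    · exact min_le_right _ _
    · rcases le_total (k : ℝ) (α * lam) with h | h
      · rw [max_eq_left (by linarith)]; simp
      · rw [min_eq_right (a := (k : ℝ) / α) (by rw [le_div_iff₀ hα]; linarith)]; simp
  have hrec : ∀ k : ℕ, min ((k : ℝ) / α) lam
      + α⁻¹ * (1 - min 1 (max 0 (((k + 1 : ℕ) : ℝ) - α * lam)))
      = min (((k + 1 : ℕ) : ℝ) / α) lam := by
    intro k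
    push_cast
    have hmn : ∀ x : ℝ, min (x / α) lam = min x (α * lam) / α := by
      intro x
      rw [← min_div_div_right hα.le, mul_div_cancel_left₀ _ hα.ne']
    rw [hmn, hmn]
    rw [← aux_real k (α * lam)]
    ring
  have main : ∀ k : ℕ, u k = (min 1 (max 0 ((k : ℝ) - α * lam))) • f ∧
      p k = (min ((k : ℝ) / α) lam) • f := by
    intro k
    induction k with
    | zero =>
      have : 0 < α * lam := by positivity
      rw [hu0, hp0]
      constructor
      · rw [max_eq_left (by push_cast; linarith)]; simp
      · rw [min_eq_left (by simpa using hlam.le)]; simp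
    | succ k ih =>
      have hp : ∀ x : H, x = (min 1 (max 0 (((k + 1 : ℕ) : ℝ) - α * lam))) • f →
          p k + α⁻¹ • (f - x) = (min (((k + 1 : ℕ) : ℝ) / α) lam) • f := by
        intro x hx
        rw [hx, ih.2, ← hrec k]
        module
      have hu : u (k + 1) = (min 1 (max 0 (((k + 1 : ℕ) : ℝ) - α * lam))) • f := by
        apply aux_unique J f α hα _ _ (p k) (hmin k _)
        rw [hp _ rfl]
        exact hcoef (k + 1)
      exact ⟨hu, by rw [hpupd, hp _ hu]⟩
  intro k
  obtain ⟨h1, h2⟩ := main k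
  refine ⟨h1, h2, ?_, ?_, ?_⟩
  · rw [h1, h2]; exact hcoef k
  · intro h
    rw [h1, max_eq_left (by linarith)]; simp
  · intro h
    rw [h1, min_eq_left (le_max_of_le_right (by linarith)), one_smul]
end

section
/- Let H be a real Hilbert space, J : H → ℝ convex, positively one-homogeneous and nonnegative, and let u₀ ∈ H, λ > 0 with λ·u₀ ∈ ∂J(u₀), where ∂J(u) = { p ∈ H : ∀ v, J(v) ≥ J(u) + ⟨p, v − u⟩ }. Define u : [0, ∞) → H by u(t) = max(1 − λ·t, 0)·u₀. Then u(0) = u₀ and u solves the gradient flow u′(t) ∈ −∂J(u(t)) away from the extinction time: for every t ∈ (0, 1/λ), u′(t) = −λ·u₀ and λ·u₀ ∈ ∂J(u(t)); and for every t > 1/λ, u(t) = 0, u′(t) = 0 and 0 ∈ ∂J(0). The extinction time is exactly 1/λ. -/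
open scoped RealInnerProductSpace

/-- For an eigenfunction `λ·u₀ ∈ ∂J(u₀)` of a convex, positively
one-homogeneous, nonnegative `J` on a real Hilbert space, `u(t) = max(1 − λt, 0)·u₀`
solves the gradient flow `u′ ∈ −∂J(u)` away from the extinction time: `u(0) = u₀`;
for `t ∈ (0, 1/λ)`, `u′(t) = −λu₀` with `λu₀ ∈ ∂J(u(t))`; for `t > 1/λ`, `u(t) = 0`,
`u′(t) = 0` and `0 ∈ ∂J(0)`; and the extinction time is exactly `1/λ`. -/
theorem stmt10 {H : Type*} [NormedAddCommGroup H] [InnerProductSpace ℝ H] [CompleteSpace H]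
    (J : H → ℝ) (hconv : ConvexOn ℝ Set.univ J)
    (hhom : ∀ c : ℝ, 0 ≤ c → ∀ u : H, J (c • u) = c * J u)
    (hnonneg : ∀ u, 0 ≤ J u)
    (u₀ : H) (lam : ℝ) (hlam : 0 < lam) (heig : lam • u₀ ∈ subdiff J u₀)
    (u : ℝ → H) (hu : ∀ t, u t = (max (1 - lam * t) 0) • u₀) :
    u 0 = u₀ ∧
    (∀ t ∈ Set.Ioo (0:ℝ) (1/lam),
      HasDerivAt u (-(lam • u₀)) t ∧ lam • u₀ ∈ subdiff J (u t)) ∧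
    (∀ t : ℝ, 1/lam < t → u t = 0 ∧ HasDerivAt u 0 t ∧ (0:H) ∈ subdiff J 0) ∧
    (∀ t : ℝ, 1/lam ≤ t → u t = 0) ∧
    (u₀ ≠ 0 → ∀ t ∈ Set.Ico (0:ℝ) (1/lam), u t ≠ 0) := by
  have hlt : ∀ t : ℝ, t < 1/lam → 0 < 1 - lam * t := by
    intro t ht
    have := (lt_div_iff₀ hlam).1 ht
    linarith
  have hge : ∀ t : ℝ, 1/lam ≤ t → 1 - lam * t ≤ 0 := by
    intro t ht
    have := (div_le_iff₀ hlam).1 ht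
    linarith
  have hzero : ∀ t : ℝ, 1/lam ≤ t → u t = 0 := by
    intro t ht
    rw [hu, max_eq_right (hge t ht), zero_smul]
  refine ⟨by simp [hu], ?_, ?_, hzero, ?_⟩
  · intro t ht
    constructor
    · have h1 : HasDerivAt (fun s : ℝ => (1 - lam * s)) (-lam) t := by
        simpa using ((hasDerivAt_id t).const_mul lam).const_sub 1
      have h2 := h1.smul_const u₀
      rw [neg_smul] at h2
      refine h2.congr_of_eventuallyEq ?_
      filter_upwards [Iio_mem_nhds ht.2] with s hs
      rw [hu, max_eq_left (hlt s hs).le]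
    · intro v
      have hc := hlt t ht.2
      rw [hu, max_eq_left hc.le]
      generalize 1 - lam * t = c at hc
      have h := heig (c⁻¹ • v)
      have h3 := mul_le_mul_of_nonneg_left h hc.le
      rw [← hhom c hc.le (c⁻¹ • v), smul_inv_smul₀ hc.ne', mul_add,
        ← real_inner_smul_right, smul_sub, smul_inv_smul₀ hc.ne', ← hhom c hc.le] at h3
      exact h3
  · intro t ht
    refine ⟨hzero t ht.le, ?_, ?_⟩
    · refine (hasDerivAt_const t (0:H)).congr_of_eventuallyEq ?_
      filter_upwards [Ioi_mem_nhds ht] with s hs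
      exact hzero s (le_of_lt hs)
    · intro v
      have h0 : J 0 = 0 := by simpa using hhom 0 le_rfl 0
      simpa [h0] using hnonneg v
  · intro h0 t ht
    rw [hu, max_eq_left (hlt t ht.2).le]
    exact smul_ne_zero (hlt t ht.2).ne' h0
end

section
/- Let H be a real Hilbert space, J : H → ℝ convex, and let f, p ∈ H and α > 0. If u⁺ ∈ H minimizes the functional u ↦ (1/2)‖u − f‖² + α·(J(u) − ⟨p, u⟩) over H, then p⁺ := p + (1/α)(f − u⁺) belongs to the subdifferential ∂J(u⁺) = { q ∈ H : ∀ v, J(v) ≥ J(u⁺) + ⟨q, v − u⁺⟩ }. Thus each Bregman iteration step automatically produces a subgradient of J at the new iterate via the update p_{k+1} = p_k + (1/α)(f − u_{k+1}). -/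
open scoped RealInnerProductSpace

/-- For convex `J` on a real Hilbert space, if `u⁺` minimizes
`u ↦ (1/2)‖u − f‖² + α(J(u) − ⟪p, u⟫)` then `p⁺ = p + (1/α)(f − u⁺) ∈ ∂J(u⁺)`:
each Bregman step automatically produces a subgradient at the new iterate. -/
theorem stmt11 {H : Type*} [NormedAddCommGroup H] [InnerProductSpace ℝ H] [CompleteSpace H]
    (J : H → ℝ) (hconv : ConvexOn ℝ Set.univ J)
    (f p : H) (α : ℝ) (hα : 0 < α) (uplus : H)
    (hmin : ∀ v : H,
      (1/2) * ‖uplus - f‖^2 + α * (J uplus - ⟪p, uplus⟫)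
        ≤ (1/2) * ‖v - f‖^2 + α * (J v - ⟪p, v⟫)) :
    p + α⁻¹ • (f - uplus) ∈ subdiff J uplus := by
  intro v
  obtain ⟨d, rfl⟩ : ∃ d, v = uplus + d := ⟨v - uplus, by abel⟩
  rw [add_sub_cancel_left, inner_add_left, real_inner_smul_left]
  have key : ∀ t : ℝ, 0 < t → t ≤ 1 →
      0 ≤ (⟪uplus - f, d⟫ + α * (J (uplus + d) - J uplus - ⟪p, d⟫)) + t * (‖d‖^2 / 2) := by
    intro t ht ht1
    have h1 := hmin (uplus + t • d)
    have h2 := hconv.2 (Set.mem_univ uplus) (Set.mem_univ (uplus + d))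
      (by linarith : (0:ℝ) ≤ 1 - t) ht.le (by ring)
    have e : (1 - t) • uplus + t • (uplus + d) = uplus + t • d := by module
    rw [e, smul_eq_mul, smul_eq_mul] at h2
    have e2 : uplus + t • d - f = (uplus - f) + t • d := by abel
    rw [e2, norm_add_sq_real, inner_add_right, real_inner_smul_right, real_inner_smul_right,
      norm_smul, mul_pow, Real.norm_eq_abs, sq_abs] at h1
    have h3 := mul_le_mul_of_nonneg_left h2 hα.le
    refine nonneg_of_mul_nonneg_right (a := t) ?_ ht
    nlinarith
  have e3 : ⟪f - uplus, d⟫ = - ⟪uplus - f, d⟫ := by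
    rw [← inner_neg_left, neg_sub]
  rw [e3]
  set A := ⟪uplus - f, d⟫ + α * (J (uplus + d) - J uplus - ⟪p, d⟫) with hA
  have hB : 0 ≤ ‖d‖^2 / 2 := by positivity
  set B := ‖d‖^2 / 2
  have hA0 : 0 ≤ A := by
    by_contra! hneg
    have hD : 0 < 2 * B - A := by linarith
    have h := key (-A / (2 * B - A)) (div_pos (by linarith) hD)
      ((div_le_one hD).2 (by linarith))
    have h' : A + -A / (2 * B - A) * B = A * (B - A) / (2 * B - A) := by
      field_simp
      ring
    rw [h'] at h
    have : A * (B - A) / (2 * B - A) < 0 :=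
      div_neg_of_neg_of_pos (mul_neg_of_neg_of_pos hneg (by linarith)) hD
    linarith
  have h4 : 0 ≤ α⁻¹ * A := by positivity
  have h5 : α⁻¹ * A = α⁻¹ * ⟪uplus - f, d⟫ + (J (uplus + d) - J uplus - ⟪p, d⟫) := by
    rw [hA]
    field_simp
  linarith
end

section
/- Let H be a real Banach space and u : [0, ∞) → H be continuously differentiable on [0, ∞) and twice continuously differentiable on (0, ∞), with u(0) = f. Assume that u(T) → f̄ in H and T·u′(T) → 0 in H as T → ∞, and that the function t ↦ t·u″(t) is Bochner integrable on (0, ∞). Then the spectral transform φ(t) := t·u″(t) reconstructs the initial datum: ∫₀^∞ φ(t) dt = f − f̄, i.e. f = ∫₀^∞ φ(t) dt + f̄. -/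
open MeasureTheory

/-- Reconstruction formula of the spectral transform. If `u : [0,∞) → H`
(`H` a real Banach space) is `C¹` on `[0,∞)` and `C²` on `(0,∞)` with `u(0) = f`,
`u(T) → f̄` and `T·u′(T) → 0` as `T → ∞`, and `t ↦ t·u″(t)` is Bochner integrable on
`(0,∞)`, then the spectral transform `φ(t) = t·u″(t)` satisfies `∫₀^∞ φ(t) dt = f − f̄`. -/
theorem stmt12 {H : Type*} [NormedAddCommGroup H] [NormedSpace ℝ H] [CompleteSpace H]
    (u : ℝ → H) (f fbar : H)
    (hC1 : ContDiffOn ℝ 1 u (Set.Ici 0))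
    (hC2 : ContDiffOn ℝ 2 u (Set.Ioi 0))
    (hu0 : u 0 = f)
    (hlim : Filter.Tendsto u Filter.atTop (nhds fbar))
    (hlim' : Filter.Tendsto (fun T : ℝ => T • deriv u T) Filter.atTop (nhds 0))
    (hint : IntegrableOn (fun t : ℝ => t • deriv (deriv u) t) (Set.Ioi 0)) :
    ∫ t in Set.Ioi (0:ℝ), t • deriv (deriv u) t = f - fbar := by
  have hdu : ∀ x ∈ Set.Ioi (0:ℝ), HasDerivAt u (deriv u x) x := fun x hx =>
    ((hC2.differentiableOn (by norm_num)).differentiableAt (Ioi_mem_nhds hx)).hasDerivAt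
  have hddu : ∀ x ∈ Set.Ioi (0:ℝ), HasDerivAt (deriv u) (deriv (deriv u) x) x := by
    intro x hx
    have h : ContDiffOn ℝ 1 (deriv u) (Set.Ioi 0) :=
      hC2.deriv_of_isOpen isOpen_Ioi (by norm_num)
    exact ((h.differentiableOn (by norm_num)).differentiableAt (Ioi_mem_nhds hx)).hasDerivAt
  have hcont : ContinuousWithinAt (fun t : ℝ => t • deriv u t - u t) (Set.Ici 0) 0 := by
    have h1 : ContinuousOn (derivWithin u (Set.Ici 0)) (Set.Ici 0) :=
      hC1.continuousOn_derivWithin (uniqueDiffOn_Ici 0) le_rfl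
    have h2 : ContinuousOn (fun t : ℝ => t • derivWithin u (Set.Ici 0) t - u t) (Set.Ici 0) :=
      (continuousOn_id.smul h1).sub hC1.continuousOn
    refine (h2 0 Set.self_mem_Ici).congr (fun t ht => ?_) (by simp)
    rcases (Set.mem_Ici.1 ht).eq_or_lt with rfl | h
    · simp
    · rw [derivWithin_of_mem_nhds (Ici_mem_nhds h)]
  have key := integral_Ioi_of_hasDerivAt_of_tendsto (f := fun t : ℝ => t • deriv u t - u t)
    (f' := fun t : ℝ => t • deriv (deriv u) t) hcont (fun x hx => by
      have := ((hasDerivAt_id x).smul (hddu x hx)).sub (hdu x hx)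
      simp only [id, one_smul, add_sub_cancel_right] at this
      exact this) hint (hlim'.sub hlim)
  rw [key, ← hu0]
  simp [sub_eq_add_neg, add_comm]
end
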